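/- For every δ > 0 and all x₁, x₂ ∈ E_γ^δ, one has μ_γ(B^δ(x₁)) = μ_γ(B^δ(x₂)); consequently, every x̄ ∈ E_γ^δ satisfies μ_γ(B^δ(x̄)) = max_{x ∈ X} μ_γ(B^δ(x)) > 0. -/

import Mathlib

open MeasureTheory Metric Filter Topology

/-- The space `c₀` of real sequences converging to zero, with the supremum norm,
realized as the zero-at-infinity continuous maps on `ℕ`. -/
abbrev CZero : Type := ZeroAtInftyContinuousMap ℕ ℝ

/-- The set `E_γ = {x : ∀ k, |x_k| ≤ γ_k}`. -/
def Egamma (γ : ℕ → ℝ) : Set CZero := {x | ∀ k, |x k| ≤ γ k}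

/-- The set `E_γ^δ = {x : ∀ k, |x_k| ≤ max (γ_k - δ) 0}`. -/
def EgammaD (γ : ℕ → ℝ) (δ : ℝ) : Set CZero := {x | ∀ k, |x k| ≤ max (γ k - δ) 0}

/-- The law `ν_k` of `γ_k ξ_k` where `ξ_k` is uniform on `[-1,1]`: the uniform distribution
on `[-γ_k, γ_k]` if `γ_k > 0`, and the Dirac measure at `0` if `γ_k = 0`. -/
noncomputable def nuMeas (γ : ℕ → ℝ) (k : ℕ) : Measure ℝ :=
  if γ k = 0 then Measure.dirac 0
  else (ENNReal.ofReal (2 * γ k))⁻¹ • volume.restrict (Set.Icc (-(γ k)) (γ k))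

/-- `μ` is the law on `c₀` of the random series `ξ = Σ γ_k ξ_k e_k` with `ξ_k` i.i.d. uniform
on `[-1,1]` (equivalently, the pushforward under `t ↦ (γ_k t_k)_k` of the countable product of
uniform measures on `[-1,1]`), characterized by its finite-dimensional marginals: the
coordinates are independent with `x_k ∼ ν_k`. -/
def IsUniformSeriesLaw (γ : ℕ → ℝ) {m : MeasurableSpace CZero} (μ : Measure CZero) : Prop :=
  ∀ (n : ℕ) (A : ℕ → Set ℝ), (∀ k, MeasurableSet (A k)) →
    μ {x : CZero | ∀ k < n, x k ∈ A k} = ∏ k ∈ Finset.range n, nuMeas γ k (A k)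

/-- The maximal probability of an open ball of radius `δ` under `μ`. -/
noncomputable def maxBallProb {X : Type*} [PseudoMetricSpace X] [MeasurableSpace X]
    (μ : Measure X) (δ : ℝ) : ℝ :=
  ⨆ x : X, (μ (ball x δ)).toReal

/-- `xhat` is a strong mode of `μ` if `μ(B^δ(xhat))/M^δ → 1` as `δ → 0⁺`. -/
def IsStrongMode {X : Type*} [PseudoMetricSpace X] [MeasurableSpace X]
    (μ : Measure X) (xhat : X) : Prop :=
  Tendsto (fun δ : ℝ => (μ (ball xhat δ)).toReal / maxBallProb μ δ) (𝓝[>] (0 : ℝ)) (𝓝 1)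

/-- `xhat` is a generalized mode of `μ` if for every positive sequence `δ_n → 0` there is an
approximating sequence `w_n → xhat` with `μ(B^{δ_n}(w_n))/M^{δ_n} → 1`. -/
def IsGeneralizedMode {X : Type*} [PseudoMetricSpace X] [MeasurableSpace X]
    (μ : Measure X) (xhat : X) : Prop :=
  ∀ δ : ℕ → ℝ, (∀ n, 0 < δ n) → Tendsto δ atTop (𝓝 (0 : ℝ)) →
    ∃ w : ℕ → X, Tendsto w atTop (𝓝 xhat) ∧
      Tendsto (fun n => (μ (ball (w n) (δ n))).toReal / maxBallProb μ (δ n)) atTop (𝓝 1)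

/-- A ball of `c₀` is the product of the balls of its coordinates. -/
theorem CZero.mem_ball_iff (x y : CZero) {δ : ℝ} (hδ : 0 < δ) :
    y ∈ ball x δ ↔ ∀ k, y k ∈ Set.Ioo (x k - δ) (x k + δ) := by
  have hdist : ∀ k, dist (y k) (x k) ≤ dist y x := fun k => by
    rw [← ZeroAtInftyContinuousMap.dist_toBCF_eq_dist]
    exact BoundedContinuousFunction.dist_coe_le_dist (f := y.toBCF) (g := x.toBCF) k
  simp only [← Real.ball_eq_Ioo, mem_ball]
  refine ⟨fun h k => (hdist k).trans_lt h, fun h => ?_⟩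
  have hlim : Tendsto (fun k => dist (y k) (x k)) (cocompact ℕ) (𝓝 0) := by
    simpa using (zero_at_infty y).dist (zero_at_infty x)
  rw [cocompact_eq_cofinite, Nat.cofinite_eq_atTop] at hlim
  obtain ⟨N, hN⟩ := eventually_atTop.1 (hlim.eventually_lt_const (half_pos hδ))
  obtain ⟨m, -, hm⟩ := (Finset.range (N + 1)).exists_max_image (fun k => dist (y k) (x k))
    ⟨0, by simp⟩
  refine lt_of_le_of_lt ?_ (max_lt (h m) (half_lt_self hδ))
  rw [← ZeroAtInftyContinuousMap.dist_toBCF_eq_dist]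
  refine (BoundedContinuousFunction.dist_le (le_max_of_le_left dist_nonneg)).2 fun k => ?_
  rcases lt_or_ge k N with hk | hk
  · exact le_max_of_le_left (hm k (Finset.mem_range.2 (by omega)))
  · exact le_max_of_le_right (hN k hk).le

theorem CZero.continuous_eval (k : ℕ) : Continuous fun x : CZero => x k := by
  refine LipschitzWith.continuous (K := 1) (LipschitzWith.mk_one fun x y => ?_)
  rw [← ZeroAtInftyContinuousMap.dist_toBCF_eq_dist]
  exact BoundedContinuousFunction.dist_coe_le_dist (f := x.toBCF) (g := y.toBCF) k

theorem nuMeas_Ioo_of_pos {γ : ℕ → ℝ} {k : ℕ} (hk : 0 < γ k) (a b : ℝ) :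
    nuMeas γ k (Set.Ioo a b) =
      (ENNReal.ofReal (2 * γ k))⁻¹ * ENNReal.ofReal (min b (γ k) - max a (-(γ k))) := by
  rw [nuMeas, if_neg hk.ne', Measure.smul_apply, smul_eq_mul,
    Measure.restrict_congr_set Ioo_ae_eq_Icc.symm, Measure.restrict_apply measurableSet_Ioo,
    Set.Ioo_inter_Ioo, Real.volume_Ioo]

theorem nuMeas_Ioo_le {γ : ℕ → ℝ} {k : ℕ} (hk : 0 ≤ γ k) {δ : ℝ} (hδ : 0 < δ) {t : ℝ}
    (ht : |t| ≤ max (γ k - δ) 0) (s : ℝ) :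
    nuMeas γ k (Set.Ioo (s - δ) (s + δ)) ≤ nuMeas γ k (Set.Ioo (t - δ) (t + δ)) := by
  rcases hk.eq_or_lt with h0 | hpos
  · have ht0 : t = 0 := by simpa [← h0, hδ.le] using ht
    rw [nuMeas, if_pos h0.symm, Measure.dirac_apply' _ measurableSet_Ioo,
      Measure.dirac_apply' _ measurableSet_Ioo, ht0]
    simp only [Set.indicator, Set.mem_Ioo, Pi.one_apply]
    rw [if_pos (show 0 - δ < 0 ∧ 0 < 0 + δ by constructor <;> linarith)]
    split_ifs <;> simp
  · rw [nuMeas_Ioo_of_pos hpos, nuMeas_Ioo_of_pos hpos]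
    refine mul_le_mul' le_rfl (ENNReal.ofReal_le_ofReal ?_)
    have := abs_le.1 ht
    grind

theorem nuMeas_Ioo_pos {γ : ℕ → ℝ} {k : ℕ} (hk : 0 ≤ γ k) {δ : ℝ} (hδ : 0 < δ) {t : ℝ}
    (ht : |t| ≤ max (γ k - δ) 0) : 0 < nuMeas γ k (Set.Ioo (t - δ) (t + δ)) := by
  refine lt_of_lt_of_le ?_ (nuMeas_Ioo_le hk hδ ht 0)
  rcases hk.eq_or_lt with h0 | hpos
  · rw [nuMeas, if_pos h0.symm, Measure.dirac_apply' _ measurableSet_Ioo]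
    simp [hδ]
  · rw [nuMeas_Ioo_of_pos hpos]
    refine ENNReal.mul_pos (ENNReal.inv_ne_zero.2 ENNReal.ofReal_ne_top) (ENNReal.ofReal_pos.2 ?_).ne'
    grind

theorem nuMeas_Ioo_eq_one {γ : ℕ → ℝ} {k : ℕ} (hk : 0 ≤ γ k) {δ : ℝ} (hδ : γ k < δ) {t : ℝ}
    (ht : |t| ≤ max (γ k - δ) 0) : nuMeas γ k (Set.Ioo (t - δ) (t + δ)) = 1 := by
  have ht0 : t = 0 := by
    rw [max_eq_right (by linarith)] at ht
    simpa using ht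
  subst ht0
  rcases hk.eq_or_lt with h0 | hpos
  · rw [nuMeas, if_pos h0.symm, Measure.dirac_apply' _ measurableSet_Ioo]
    simp [h0 ▸ hδ]
  · have hlen : min (0 + δ) (γ k) - max (0 - δ) (-(γ k)) = 2 * γ k := by grind
    rw [nuMeas_Ioo_of_pos hpos, hlen]
    exact ENNReal.inv_mul_cancel (by simpa using hpos) ENNReal.ofReal_ne_top

/-- Ball probabilities are the limits of the finite products of the coordinate probabilities. -/
theorem IsUniformSeriesLaw.tendsto_prod_ball {γ : ℕ → ℝ} [MeasurableSpace CZero]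
    [BorelSpace CZero] {μ : Measure CZero} [IsFiniteMeasure μ] (hμ : IsUniformSeriesLaw γ μ)
    {δ : ℝ} (hδ : 0 < δ) (x : CZero) :
    Tendsto (fun n => ∏ k ∈ Finset.range n, nuMeas γ k (Set.Ioo (x k - δ) (x k + δ))) atTop
      (𝓝 (μ (ball x δ))) := by
  have hball : ball x δ = ⋂ n : ℕ, {y : CZero | ∀ k < n, y k ∈ Set.Ioo (x k - δ) (x k + δ)} := by
    ext y
    rw [CZero.mem_ball_iff x y hδ, Set.mem_iInter]
    exact ⟨fun h n k _ => h k, fun h k => h (k + 1) k k.lt_succ_self⟩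
  simp_rw [← hμ _ (fun k => Set.Ioo (x k - δ) (x k + δ)) fun _ => measurableSet_Ioo]
  rw [hball]
  refine tendsto_measure_iInter_atTop (fun n => ?_)
    (fun m n hmn y hy k hk => hy k (hk.trans_le hmn)) ⟨0, measure_ne_top _ _⟩
  have hset : {y : CZero | ∀ k < n, y k ∈ Set.Ioo (x k - δ) (x k + δ)} =
      ⋂ k, ⋂ _ : k < n, (fun y : CZero => y k) ⁻¹' Set.Ioo (x k - δ) (x k + δ) := by
    ext y
    simp
  rw [hset]
  exact (MeasurableSet.iInter fun k => MeasurableSet.iInter fun _ =>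
    (CZero.continuous_eval k).measurable measurableSet_Ioo).nullMeasurableSet

theorem uniform_ball_prob_const_on_EgammaD (γ : ℕ → ℝ) (hγ0 : ∀ k, 0 ≤ γ k)
    (hγ : Tendsto γ atTop (𝓝 (0 : ℝ)))
    [MeasurableSpace CZero] [BorelSpace CZero]
    (μ : Measure CZero) [IsProbabilityMeasure μ] (hμ : IsUniformSeriesLaw γ μ)
    (δ : ℝ) (hδ : 0 < δ) :
    (∀ x₁ ∈ EgammaD γ δ, ∀ x₂ ∈ EgammaD γ δ, μ (ball x₁ δ) = μ (ball x₂ δ)) ∧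
      ∀ xbar ∈ EgammaD γ δ,
        (∀ x : CZero, μ (ball x δ) ≤ μ (ball xbar δ)) ∧ 0 < μ (ball xbar δ) := by
  have hmax : ∀ z ∈ EgammaD γ δ, ∀ x : CZero, μ (ball x δ) ≤ μ (ball z δ) := fun z hz x =>
    le_of_tendsto_of_tendsto' (hμ.tendsto_prod_ball hδ x) (hμ.tendsto_prod_ball hδ z) fun n =>
      Finset.prod_le_prod' fun k _ => nuMeas_Ioo_le (hγ0 k) hδ (hz k) (x k)
  refine ⟨fun x₁ h₁ x₂ h₂ => le_antisymm (hmax x₂ h₂ x₁) (hmax x₁ h₁ x₂),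
    fun z hz => ⟨hmax z hz, ?_⟩⟩
  obtain ⟨N, hN⟩ := eventually_atTop.1 (hγ.eventually_lt_const hδ)
  have hconst : ∀ n ≥ N, ∏ k ∈ Finset.range n, nuMeas γ k (Set.Ioo (z k - δ) (z k + δ)) =
      ∏ k ∈ Finset.range N, nuMeas γ k (Set.Ioo (z k - δ) (z k + δ)) := fun n hn =>
    (Finset.prod_subset (Finset.range_mono hn) fun k _ hk =>
      nuMeas_Ioo_eq_one (hγ0 k) (hN k (by simpa using hk)) (hz k)).symm
  rw [tendsto_nhds_unique (hμ.tendsto_prod_ball hδ z)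
    (tendsto_atTop_of_eventually_const hconst), pos_iff_ne_zero, Finset.prod_ne_zero_iff]
  exact fun k _ => (nuMeas_Ioo_pos (hγ0 k) hδ (hz k)).ne'
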